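/- Let N₁ = span_ℝ{[J_k, J_l] : k < l, k, l ∈ {1,2,3,5,6,7}} and let Y = (y₁,…,y₈) ∈ ℝ⁸ with y₁ ≠ 0. If there is no matrix B ∈ N₁ satisfying B·Y = J₄·Y, then either Y = (y₁, y₂, y₃, y₄, y₁, y₄, y₃, y₂) or Y = (y₁, y₂, y₃, y₄, −y₁, −y₄, −y₃, −y₂). -/

import Mathlib

open Matrix

noncomputable section

/-- The Clifford map `J_{Z₁}` of the pseudo H-type Lie algebra `n_{3,4}`. -/
def J1 : Matrix (Fin 8) (Fin 8) ℝ :=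
  !![0,-1,0,0,0,0,0,0;
     1,0,0,0,0,0,0,0;
     0,0,0,1,0,0,0,0;
     0,0,-1,0,0,0,0,0;
     0,0,0,0,0,0,0,1;
     0,0,0,0,0,0,1,0;
     0,0,0,0,0,-1,0,0;
     0,0,0,0,-1,0,0,0]

/-- The Clifford map `J_{Z₂}`. -/
def J2 : Matrix (Fin 8) (Fin 8) ℝ :=
  !![0,0,-1,0,0,0,0,0;
     0,0,0,-1,0,0,0,0;
     1,0,0,0,0,0,0,0;
     0,1,0,0,0,0,0,0;
     0,0,0,0,0,0,1,0;
     0,0,0,0,0,0,0,-1;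
     0,0,0,0,-1,0,0,0;
     0,0,0,0,0,1,0,0]

/-- The Clifford map `J_{Z₃}`. -/
def J3 : Matrix (Fin 8) (Fin 8) ℝ :=
  !![0,0,0,-1,0,0,0,0;
     0,0,1,0,0,0,0,0;
     0,-1,0,0,0,0,0,0;
     1,0,0,0,0,0,0,0;
     0,0,0,0,0,1,0,0;
     0,0,0,0,-1,0,0,0;
     0,0,0,0,0,0,0,1;
     0,0,0,0,0,0,-1,0]

/-- The Clifford map `J_{Z₄}`. -/
def J4 : Matrix (Fin 8) (Fin 8) ℝ :=
  !![0,0,0,0,1,0,0,0;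
     0,0,0,0,0,0,0,1;
     0,0,0,0,0,0,1,0;
     0,0,0,0,0,1,0,0;
     1,0,0,0,0,0,0,0;
     0,0,0,1,0,0,0,0;
     0,0,1,0,0,0,0,0;
     0,1,0,0,0,0,0,0]

/-- The Clifford map `J_{Z₅}`. -/
def J5 : Matrix (Fin 8) (Fin 8) ℝ :=
  !![0,0,0,0,0,1,0,0;
     0,0,0,0,0,0,1,0;
     0,0,0,0,0,0,0,-1;
     0,0,0,0,-1,0,0,0;
     0,0,0,-1,0,0,0,0;
     1,0,0,0,0,0,0,0;
     0,1,0,0,0,0,0,0;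
     0,0,-1,0,0,0,0,0]

/-- The Clifford map `J_{Z₆}`. -/
def J6 : Matrix (Fin 8) (Fin 8) ℝ :=
  !![0,0,0,0,0,0,1,0;
     0,0,0,0,0,-1,0,0;
     0,0,0,0,-1,0,0,0;
     0,0,0,0,0,0,0,1;
     0,0,-1,0,0,0,0,0;
     0,-1,0,0,0,0,0,0;
     1,0,0,0,0,0,0,0;
     0,0,0,1,0,0,0,0]

/-- The Clifford map `J_{Z₇}`. -/
def J7 : Matrix (Fin 8) (Fin 8) ℝ :=
  !![0,0,0,0,0,0,0,1;
     0,0,0,0,-1,0,0,0;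
     0,0,0,0,0,1,0,0;
     0,0,0,0,0,0,-1,0;
     0,-1,0,0,0,0,0,0;
     0,0,1,0,0,0,0,0;
     0,0,0,-1,0,0,0,0;
     1,0,0,0,0,0,0,0]

/-- The family `J₁, …, J₇`. -/
def J : Fin 7 → Matrix (Fin 8) (Fin 8) ℝ := ![J1, J2, J3, J4, J5, J6, J7]

/-- `N = span ℝ {[Jᵢ, Jⱼ] : 1 ≤ i < j ≤ 7}`, the normalizer of `V = span {J₁,…,J₇}`
in `so(4,4)`. -/
def NN : Submodule ℝ (Matrix (Fin 8) (Fin 8) ℝ) :=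
  Submodule.span ℝ {M | ∃ i j : Fin 7, i < j ∧ M = J i * J j - J j * J i}

/-- `N₁ = span ℝ {[J_k, J_l] : k < l, k, l ∈ {1,2,3,5,6,7}}` (the commutators not
involving `J₄`). -/
def N1 : Submodule ℝ (Matrix (Fin 8) (Fin 8) ℝ) :=
  Submodule.span ℝ
    {M | ∃ k l : Fin 7, k < l ∧ k ≠ 3 ∧ l ≠ 3 ∧ M = J k * J l - J l * J k}

lemma J1_mv (Y : Fin 8 → ℝ) : J1 *ᵥ Y = ![-Y 1, Y 0, Y 3, -Y 2, Y 7, Y 6, -Y 5, -Y 4] := by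
  ext i; fin_cases i <;> simp [J1, Matrix.mulVec, dotProduct, Fin.sum_univ_succ]

lemma J2_mv (Y : Fin 8 → ℝ) : J2 *ᵥ Y = ![-Y 2, -Y 3, Y 0, Y 1, Y 6, -Y 7, -Y 4, Y 5] := by
  ext i; fin_cases i <;> simp [J2, Matrix.mulVec, dotProduct, Fin.sum_univ_succ]

lemma J3_mv (Y : Fin 8 → ℝ) : J3 *ᵥ Y = ![-Y 3, Y 2, -Y 1, Y 0, Y 5, -Y 4, Y 7, -Y 6] := by
  ext i; fin_cases i <;> simp [J3, Matrix.mulVec, dotProduct, Fin.sum_univ_succ]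

lemma J4_mv (Y : Fin 8 → ℝ) : J4 *ᵥ Y = ![Y 4, Y 7, Y 6, Y 5, Y 0, Y 3, Y 2, Y 1] := by
  ext i; fin_cases i <;> simp [J4, Matrix.mulVec, dotProduct, Fin.sum_univ_succ]

lemma J5_mv (Y : Fin 8 → ℝ) : J5 *ᵥ Y = ![Y 5, Y 6, -Y 7, -Y 4, -Y 3, Y 0, Y 1, -Y 2] := by
  ext i; fin_cases i <;> simp [J5, Matrix.mulVec, dotProduct, Fin.sum_univ_succ]

lemma J6_mv (Y : Fin 8 → ℝ) : J6 *ᵥ Y = ![Y 6, -Y 5, -Y 4, Y 7, -Y 2, -Y 1, Y 0, Y 3] := by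
  ext i; fin_cases i <;> simp [J6, Matrix.mulVec, dotProduct, Fin.sum_univ_succ]

lemma J7_mv (Y : Fin 8 → ℝ) : J7 *ᵥ Y = ![Y 7, -Y 4, Y 5, -Y 6, -Y 1, Y 2, -Y 3, Y 0] := by
  ext i; fin_cases i <;> simp [J7, Matrix.mulVec, dotProduct, Fin.sum_univ_succ]

lemma memN1 (k l : Fin 7) (h : k < l) (hk : k ≠ 3) (hl : l ≠ 3) (c : ℝ) :
    c • (J k * J l - J l * J k) ∈ N1 :=
  N1.smul_mem _ (Submodule.subset_span ⟨k, l, h, hk, hl, rfl⟩)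

lemma existsB (Y : Fin 8 → ℝ) (a00 a01 a02 a03 a10 a11 a12 a13 a20 a21 a22 a23 a30 a31 a32 : ℝ) : ∃ B ∈ N1, B *ᵥ Y =
    ![((1/2) * a01 + (-1/2) * a10) * Y 1 + ((1/2) * a02 + (-1/2) * a20) * Y 2 + ((1/2) * a03 + (-1/2) * a30) * Y 3 + ((1) * a00) * Y 4 + ((1/2) * a03 + (1/2) * a30) * Y 5 + ((1/2) * a02 + (1/2) * a20) * Y 6 + ((1/2) * a01 + (1/2) * a10) * Y 7,
      ((1/2) * a10 + (-1/2) * a01) * Y 0 + ((1/2) * a12 + (-1/2) * a21) * Y 2 + ((1/2) * a13 + (-1/2) * a31) * Y 3 + ((1/2) * a10 + (1/2) * a01) * Y 4 + ((1/2) * a13 + (1/2) * a31) * Y 5 + ((1/2) * a12 + (1/2) * a21) * Y 6 + ((1) * a11) * Y 7,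
      ((1/2) * a20 + (-1/2) * a02) * Y 0 + ((1/2) * a21 + (-1/2) * a12) * Y 1 + ((1/2) * a23 + (-1/2) * a32) * Y 3 + ((1/2) * a20 + (1/2) * a02) * Y 4 + ((1/2) * a23 + (1/2) * a32) * Y 5 + ((1) * a22) * Y 6 + ((1/2) * a21 + (1/2) * a12) * Y 7,
      ((1/2) * a30 + (-1/2) * a03) * Y 0 + ((1/2) * a31 + (-1/2) * a13) * Y 1 + ((1/2) * a32 + (-1/2) * a23) * Y 2 + ((1/2) * a30 + (1/2) * a03) * Y 4 + ((-1) * a00 + (-1) * a11 + (-1) * a22) * Y 5 + ((1/2) * a32 + (1/2) * a23) * Y 6 + ((1/2) * a31 + (1/2) * a13) * Y 7,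
      ((1) * a00) * Y 0 + ((1/2) * a01 + (1/2) * a10) * Y 1 + ((1/2) * a02 + (1/2) * a20) * Y 2 + ((1/2) * a03 + (1/2) * a30) * Y 3 + ((1/2) * a03 + (-1/2) * a30) * Y 5 + ((1/2) * a02 + (-1/2) * a20) * Y 6 + ((1/2) * a01 + (-1/2) * a10) * Y 7,
      ((1/2) * a30 + (1/2) * a03) * Y 0 + ((1/2) * a31 + (1/2) * a13) * Y 1 + ((1/2) * a32 + (1/2) * a23) * Y 2 + ((-1) * a00 + (-1) * a11 + (-1) * a22) * Y 3 + ((1/2) * a30 + (-1/2) * a03) * Y 4 + ((1/2) * a32 + (-1/2) * a23) * Y 6 + ((1/2) * a31 + (-1/2) * a13) * Y 7,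
      ((1/2) * a20 + (1/2) * a02) * Y 0 + ((1/2) * a21 + (1/2) * a12) * Y 1 + ((1) * a22) * Y 2 + ((1/2) * a23 + (1/2) * a32) * Y 3 + ((1/2) * a20 + (-1/2) * a02) * Y 4 + ((1/2) * a23 + (-1/2) * a32) * Y 5 + ((1/2) * a21 + (-1/2) * a12) * Y 7,
      ((1/2) * a10 + (1/2) * a01) * Y 0 + ((1) * a11) * Y 1 + ((1/2) * a12 + (1/2) * a21) * Y 2 + ((1/2) * a13 + (1/2) * a31) * Y 3 + ((1/2) * a10 + (-1/2) * a01) * Y 4 + ((1/2) * a13 + (-1/2) * a31) * Y 5 + ((1/2) * a12 + (-1/2) * a21) * Y 6] := by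
  refine ⟨((1/8) * a03 + (-1/8) * a30 + (-1/8) * a12 + (1/8) * a21:ℝ) • (J 0 * J 1 - J 1 * J 0) +
    ((-1/8) * a02 + (1/8) * a20 + (-1/8) * a13 + (1/8) * a31:ℝ) • (J 0 * J 2 - J 2 * J 0) +
    ((-1/8) * a02 + (-1/8) * a20 + (1/8) * a13 + (1/8) * a31:ℝ) • (J 0 * J 4 - J 4 * J 0) +
    ((1/8) * a03 + (1/8) * a30 + (1/8) * a12 + (1/8) * a21:ℝ) • (J 0 * J 5 - J 5 * J 0) +
    ((1/4) * a00 + (1/4) * a11:ℝ) • (J 0 * J 6 - J 6 * J 0) +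
    ((1/8) * a01 + (-1/8) * a10 + (-1/8) * a23 + (1/8) * a32:ℝ) • (J 1 * J 2 - J 2 * J 1) +
    ((1/8) * a01 + (1/8) * a10 + (1/8) * a23 + (1/8) * a32:ℝ) • (J 1 * J 4 - J 4 * J 1) +
    ((1/4) * a00 + (1/4) * a22:ℝ) • (J 1 * J 5 - J 5 * J 1) +
    ((-1/8) * a03 + (-1/8) * a30 + (1/8) * a12 + (1/8) * a21:ℝ) • (J 1 * J 6 - J 6 * J 1) +
    ((-1/4) * a11 + (-1/4) * a22:ℝ) • (J 2 * J 4 - J 4 * J 2) +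
    ((-1/8) * a01 + (-1/8) * a10 + (1/8) * a23 + (1/8) * a32:ℝ) • (J 2 * J 5 - J 5 * J 2) +
    ((1/8) * a02 + (1/8) * a20 + (1/8) * a13 + (1/8) * a31:ℝ) • (J 2 * J 6 - J 6 * J 2) +
    ((-1/8) * a01 + (1/8) * a10 + (-1/8) * a23 + (1/8) * a32:ℝ) • (J 4 * J 5 - J 5 * J 4) +
    ((1/8) * a02 + (-1/8) * a20 + (-1/8) * a13 + (1/8) * a31:ℝ) • (J 4 * J 6 - J 6 * J 4) +
    ((-1/8) * a03 + (1/8) * a30 + (-1/8) * a12 + (1/8) * a21:ℝ) • (J 5 * J 6 - J 6 * J 5),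
    (N1.add_mem (N1.add_mem (N1.add_mem (N1.add_mem (N1.add_mem (N1.add_mem (N1.add_mem (N1.add_mem (N1.add_mem (N1.add_mem (N1.add_mem (N1.add_mem (N1.add_mem (N1.add_mem (memN1 0 1 (by decide) (by decide) (by decide) _)
    (memN1 0 2 (by decide) (by decide) (by decide) _))
    (memN1 0 4 (by decide) (by decide) (by decide) _))
    (memN1 0 5 (by decide) (by decide) (by decide) _))
    (memN1 0 6 (by decide) (by decide) (by decide) _))
    (memN1 1 2 (by decide) (by decide) (by decide) _))
    (memN1 1 4 (by decide) (by decide) (by decide) _))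
    (memN1 1 5 (by decide) (by decide) (by decide) _))
    (memN1 1 6 (by decide) (by decide) (by decide) _))
    (memN1 2 4 (by decide) (by decide) (by decide) _))
    (memN1 2 5 (by decide) (by decide) (by decide) _))
    (memN1 2 6 (by decide) (by decide) (by decide) _))
    (memN1 4 5 (by decide) (by decide) (by decide) _))
    (memN1 4 6 (by decide) (by decide) (by decide) _))
    (memN1 5 6 (by decide) (by decide) (by decide) _)), ?_⟩
  have h0 : J 0 = J1 := rfl
  have h1 : J 1 = J2 := rfl
  have h2 : J 2 = J3 := rfl
  have h4 : J 4 = J5 := rfl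
  have h5 : J 5 = J6 := rfl
  have h6 : J 6 = J7 := rfl
  rw [h0, h1, h2, h4, h5, h6]
  simp only [add_mulVec, smul_mulVec, sub_mulVec, ← mulVec_mulVec, J1_mv, J2_mv, J3_mv, J5_mv, J6_mv, J7_mv]
  ext i
  fin_cases i <;> simp <;> ring

lemma sq4 (a b c d : ℝ) (h : a * a + b * b + c * c + d * d ≤ 0) :
    a = 0 ∧ b = 0 ∧ c = 0 ∧ d = 0 := by
  have ha := mul_self_nonneg a
  have hb := mul_self_nonneg b
  have hc := mul_self_nonneg c
  have hd := mul_self_nonneg d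
  refine ⟨?_, ?_, ?_, ?_⟩ <;> apply mul_self_eq_zero.mp <;> linarith

set_option maxHeartbeats 2000000 in
theorem statement6 (Y : Fin 8 → ℝ) (hY : Y 0 ≠ 0)
    (h : ¬ ∃ B ∈ N1, B.mulVec Y = J4.mulVec Y) :
    (Y 4 = Y 0 ∧ Y 5 = Y 3 ∧ Y 6 = Y 2 ∧ Y 7 = Y 1) ∨
    (Y 4 = -Y 0 ∧ Y 5 = -Y 3 ∧ Y 6 = -Y 2 ∧ Y 7 = -Y 1) := by
  by_contra hcon
  apply h
  obtain ⟨u0, hu0⟩ : ∃ x, x = Y 0 + Y 4 := ⟨_, rfl⟩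
  obtain ⟨v0, hv0⟩ : ∃ x, x = Y 0 - Y 4 := ⟨_, rfl⟩
  obtain ⟨u1, hu1⟩ : ∃ x, x = Y 1 + Y 7 := ⟨_, rfl⟩
  obtain ⟨v1, hv1⟩ : ∃ x, x = Y 1 - Y 7 := ⟨_, rfl⟩
  obtain ⟨u2, hu2⟩ : ∃ x, x = Y 2 + Y 6 := ⟨_, rfl⟩
  obtain ⟨v2, hv2⟩ : ∃ x, x = Y 2 - Y 6 := ⟨_, rfl⟩
  obtain ⟨u3, hu3⟩ : ∃ x, x = Y 3 + Y 5 := ⟨_, rfl⟩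
  obtain ⟨v3, hv3⟩ : ∃ x, x = Y 3 - Y 5 := ⟨_, rfl⟩
  obtain ⟨p, hp⟩ : ∃ x, x = u0 * u0 + u1 * u1 + u2 * u2 + u3 * u3 := ⟨_, rfl⟩
  obtain ⟨q, hq⟩ : ∃ x, x = v0 * v0 + v1 * v1 + v2 * v2 + v3 * v3 := ⟨_, rfl⟩
  obtain ⟨s, hs⟩ : ∃ x, x = u0 * v0 + u1 * v1 + u2 * v2 + u3 * v3 := ⟨_, rfl⟩
  have hp0 : 0 < p := by
    by_contra hn
    apply hcon; right
    obtain ⟨k0, k1, k2, k3⟩ := sq4 u0 u1 u2 u3 (by linarith)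
    refine ⟨?_, ?_, ?_, ?_⟩ <;> linarith
  have hq0 : 0 < q := by
    by_contra hn
    apply hcon; left
    obtain ⟨k0, k1, k2, k3⟩ := sq4 v0 v1 v2 v3 (by linarith)
    refine ⟨?_, ?_, ?_, ?_⟩ <;> linarith
  have hD : 0 < 2 * p * q + s ^ 2 := by positivity
  obtain ⟨t, ht⟩ : ∃ t, t * (2 * p * q + s ^ 2) = 4 := ⟨4 / (2 * p * q + s ^ 2), by field_simp⟩
  obtain ⟨α, hα⟩ : ∃ α, α + p * q * t = 1 := ⟨1 - p * q * t, by ring⟩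
  obtain ⟨a00, hA00⟩ : ∃ x, x = (α + t * (q * u0 * u0 + p * v0 * v0 - s * v0 * u0)) := ⟨_, rfl⟩
  obtain ⟨a01, hA01⟩ : ∃ x, x = (t * (q * u0 * u1 + p * v0 * v1 - s * v0 * u1)) := ⟨_, rfl⟩
  obtain ⟨a02, hA02⟩ : ∃ x, x = (t * (q * u0 * u2 + p * v0 * v2 - s * v0 * u2)) := ⟨_, rfl⟩
  obtain ⟨a03, hA03⟩ : ∃ x, x = (t * (q * u0 * u3 + p * v0 * v3 - s * v0 * u3)) := ⟨_, rfl⟩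
  obtain ⟨a10, hA10⟩ : ∃ x, x = (t * (q * u1 * u0 + p * v1 * v0 - s * v1 * u0)) := ⟨_, rfl⟩
  obtain ⟨a11, hA11⟩ : ∃ x, x = (α + t * (q * u1 * u1 + p * v1 * v1 - s * v1 * u1)) := ⟨_, rfl⟩
  obtain ⟨a12, hA12⟩ : ∃ x, x = (t * (q * u1 * u2 + p * v1 * v2 - s * v1 * u2)) := ⟨_, rfl⟩
  obtain ⟨a13, hA13⟩ : ∃ x, x = (t * (q * u1 * u3 + p * v1 * v3 - s * v1 * u3)) := ⟨_, rfl⟩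
  obtain ⟨a20, hA20⟩ : ∃ x, x = (t * (q * u2 * u0 + p * v2 * v0 - s * v2 * u0)) := ⟨_, rfl⟩
  obtain ⟨a21, hA21⟩ : ∃ x, x = (t * (q * u2 * u1 + p * v2 * v1 - s * v2 * u1)) := ⟨_, rfl⟩
  obtain ⟨a22, hA22⟩ : ∃ x, x = (α + t * (q * u2 * u2 + p * v2 * v2 - s * v2 * u2)) := ⟨_, rfl⟩
  obtain ⟨a23, hA23⟩ : ∃ x, x = (t * (q * u2 * u3 + p * v2 * v3 - s * v2 * u3)) := ⟨_, rfl⟩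
  obtain ⟨a30, hA30⟩ : ∃ x, x = (t * (q * u3 * u0 + p * v3 * v0 - s * v3 * u0)) := ⟨_, rfl⟩
  obtain ⟨a31, hA31⟩ : ∃ x, x = (t * (q * u3 * u1 + p * v3 * v1 - s * v3 * u1)) := ⟨_, rfl⟩
  obtain ⟨a32, hA32⟩ : ∃ x, x = (t * (q * u3 * u2 + p * v3 * v2 - s * v3 * u2)) := ⟨_, rfl⟩
  obtain ⟨a33, hA33⟩ : ∃ x, x = (α + t * (q * u3 * u3 + p * v3 * v3 - s * v3 * u3)) := ⟨_, rfl⟩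
  have htr : a33 = -a00 - a11 - a22 := by
    simp only [hA00, hA11, hA22, hA33]
    linear_combination 4 * hα - ht - t * q * hp - t * p * hq + t * s * hs
  have eu0 : a00 * u0 + a01 * u1 + a02 * u2 + a03 * u3 = u0 := by
    simp only [hA00, hA01, hA02, hA03]; linear_combination u0 * hα + t * (q * u0 - s * v0) * hp.symm + t * p * v0 * hs.symm
  have ev0 : a00 * v0 + a10 * v1 + a20 * v2 + a30 * v3 = v0 := by
    simp only [hA00, hA10, hA20, hA30]; linear_combination v0 * hα + t * (p * v0 - s * u0) * hq.symm + t * q * u0 * hs.symm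
  have eu1 : a10 * u0 + a11 * u1 + a12 * u2 + a13 * u3 = u1 := by
    simp only [hA10, hA11, hA12, hA13]; linear_combination u1 * hα + t * (q * u1 - s * v1) * hp.symm + t * p * v1 * hs.symm
  have ev1 : a01 * v0 + a11 * v1 + a21 * v2 + a31 * v3 = v1 := by
    simp only [hA01, hA11, hA21, hA31]; linear_combination v1 * hα + t * (p * v1 - s * u1) * hq.symm + t * q * u1 * hs.symm
  have eu2 : a20 * u0 + a21 * u1 + a22 * u2 + a23 * u3 = u2 := by
    simp only [hA20, hA21, hA22, hA23]; linear_combination u2 * hα + t * (q * u2 - s * v2) * hp.symm + t * p * v2 * hs.symm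
  have ev2 : a02 * v0 + a12 * v1 + a22 * v2 + a32 * v3 = v2 := by
    simp only [hA02, hA12, hA22, hA32]; linear_combination v2 * hα + t * (p * v2 - s * u2) * hq.symm + t * q * u2 * hs.symm
  have eu3 : a30 * u0 + a31 * u1 + a32 * u2 + a33 * u3 = u3 := by
    simp only [hA30, hA31, hA32, hA33]; linear_combination u3 * hα + t * (q * u3 - s * v3) * hp.symm + t * p * v3 * hs.symm
  have ev3 : a03 * v0 + a13 * v1 + a23 * v2 + a33 * v3 = v3 := by
    simp only [hA03, hA13, hA23, hA33]; linear_combination v3 * hα + t * (p * v3 - s * u3) * hq.symm + t * q * u3 * hs.symm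

  clear hA00
  obtain ⟨B, hB, hBY⟩ := existsB Y a00 a01 a02 a03 a10 a11 a12 a13 a20 a21 a22 a23 a30 a31 a32
  refine ⟨B, hB, ?_⟩
  rw [hBY, J4_mv]
  subst htr
  simp only [hu0, hu1, hu2, hu3, hv0, hv1, hv2, hv3] at eu0 eu1 eu2 eu3 ev0 ev1 ev2 ev3
  ext i
  fin_cases i
  · simp; linear_combination (eu0 - ev0) / 2
  · simp; linear_combination (eu1 - ev1) / 2
  · simp; linear_combination (eu2 - ev2) / 2
  · simp; linear_combination (eu3 - ev3) / 2
  · simp; linear_combination (eu0 + ev0) / 2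
  · simp; linear_combination (eu3 + ev3) / 2
  · simp; linear_combination (eu2 + ev2) / 2
  · simp; linear_combination (eu1 + ev1) / 2

end
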